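/- arXiv:2108.12687 — 10 statements merged into one kernel-verified Lean document; each statement's English description precedes it below -/
import Mathlib

section
/- For every 2-DRGP stencil H (of size 2n × n) and every field F, the F-rank of H satisfies rk_F(H)² ≥ n; in particular rk_F(H) ≥ √n. -/
noncomputable section

/-- A square stencil (Bool matrix, `true` = ⋆) is visibly full rank if it has a
unique generalized diagonal of ⋆'s. -/
def VisFullRank {α : Type*} (M : Matrix α α Bool) : Prop :=
  ∃! σ : Equiv.Perm α, ∀ i, M i (σ i) = true

/-- The visible rank of a stencil: the largest `k` admitting a `k × k`
visibly full rank sub-stencil. -/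
def vrk {α β : Type*} (H : Matrix α β Bool) : ℕ :=
  sSup {k : ℕ | ∃ r : Fin k → α, ∃ c : Fin k → β,
    Function.Injective r ∧ Function.Injective c ∧
    VisFullRank (Matrix.of fun i j => H (r i) (c j))}

/-- Tensor product of stencils. -/
def stTensor {α₁ β₁ α₂ β₂ : Type*} (H₁ : Matrix α₁ β₁ Bool) (H₂ : Matrix α₂ β₂ Bool) :
    Matrix (α₁ × α₂) (β₁ × β₂) Bool :=
  Matrix.of fun a b => H₁ a.1 b.1 && H₂ a.2 b.2

/-- `k`-th tensor power of a stencil. -/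
def stPow {α β : Type*} (H : Matrix α β Bool) (k : ℕ) :
    Matrix (Fin k → α) (Fin k → β) Bool :=
  Matrix.of fun r c => decide (∀ i, H (r i) (c i) = true)

/-- `W` is an `F`-witness of the stencil `H`. -/
def IsWitness {α β F : Type*} [Field F] (H : Matrix α β Bool) (W : Matrix α β F) : Prop :=
  ∀ i j, W i j ≠ 0 ↔ H i j = true

/-- The `F`-rank of a stencil: the minimum rank of an `F`-witness. -/
def frk (F : Type*) [Field F] {α β : Type*} [Fintype β] (H : Matrix α β Bool) : ℕ :=
  sInf {r : ℕ | ∃ W : Matrix α β F, IsWitness H W ∧ W.rank = r}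

/-- A matrix over a field factors through a space of dimension its rank. -/
theorem exists_eq_mul_of_rank {α β F : Type*} [Field F] [Fintype β] (W : Matrix α β F) :
    ∃ (A : Matrix α (Fin W.rank) F) (B : Matrix (Fin W.rank) β F), W = A * B := by
  have : FiniteDimensional F (Submodule.span F (Set.range W.col)) :=
    FiniteDimensional.span_of_finite F (Set.finite_range _)
  let b := Module.finBasisOfFinrankEq F _ W.rank_eq_finrank_span_cols.symm
  let c (k : β) : Submodule.span F (Set.range W.col) :=
    ⟨W.col k, Submodule.subset_span ⟨k, rfl⟩⟩
  refine ⟨Matrix.of fun p a => (b a : α → F) p, Matrix.of fun a k => b.repr (c k) a, ?_⟩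
  ext p k
  have h : (∑ a, b.repr (c k) a • (b a : α → F)) p = W p k := by
    simp_rw [← Submodule.coe_smul, ← Submodule.coe_sum, b.sum_repr]
    rfl
  rw [← h]
  simp [Matrix.mul_apply, Finset.sum_apply, mul_comm]

/-- The entrywise product of two row selections of `W` has rank at most `W.rank ^ 2`. -/
theorem rank_hadamard_submatrix_le {ι α β F : Type*} [Field F] [Fintype β]
    (W : Matrix α β F) (f g : ι → α) :
    (Matrix.of fun i k => W (f i) k * W (g i) k).rank ≤ W.rank ^ 2 := by
  obtain ⟨A, B, h⟩ := exists_eq_mul_of_rank W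
  have hfac : (Matrix.of fun i k => W (f i) k * W (g i) k) =
      (Matrix.of fun i (p : Fin W.rank × Fin W.rank) => A (f i) p.1 * A (g i) p.2) *
        Matrix.of fun (p : Fin W.rank × Fin W.rank) k => B p.1 k * B p.2 k := by
    have hentry (p : α) (k : β) : W p k = ∑ a, A p a * B a k := by
      rw [← Matrix.mul_apply, ← h]
    ext i k
    simp only [Matrix.mul_apply, Matrix.of_apply, hentry, Finset.sum_mul_sum,
      Fintype.sum_prod_type]
    exact Finset.sum_congr rfl fun _ _ => Finset.sum_congr rfl fun _ _ => mul_mul_mul_comm _ _ _ _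
  rw [hfac]
  calc _ ≤ _ := Matrix.rank_mul_le_left _ _
    _ ≤ _ := Matrix.rank_le_card_width _
    _ = W.rank ^ 2 := by simp [sq]

/-- The minimum in the definition of the `F`-rank is attained. -/
theorem exists_isWitness_rank_eq_frk (F : Type*) [Field F] {α β : Type*} [Fintype β]
    (H : Matrix α β Bool) : ∃ W : Matrix α β F, IsWitness H W ∧ W.rank = frk F H :=
  Nat.sInf_mem (s := {r : ℕ | ∃ W : Matrix α β F, IsWitness H W ∧ W.rank = r})
    ⟨_, Matrix.of fun i j => if H i j = true then 1 else 0,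
      fun i j => by simp, rfl⟩

/-- For every 2-DRGP stencil `H` and every field `F`, `rk_F(H)² ≥ n`;
in particular `rk_F(H) ≥ √n`. -/
theorem stmt1 (n : ℕ) (H : Matrix (Fin n × Fin 2) (Fin n) Bool)
    (hdiag : ∀ (i : Fin n) (j : Fin 2), H (i, j) i = true)
    (hdisj : ∀ (i k : Fin n), k ≠ i →
      ∀ j j' : Fin 2, H (i, j) k = true → H (i, j') k = true → j = j')
    (F : Type*) [Field F] :
    n ≤ frk F H ^ 2 ∧ Real.sqrt n ≤ (frk F H : ℝ) := by
  have hsq : n ≤ frk F H ^ 2 := by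
    obtain ⟨W, hW, hr⟩ := exists_isWitness_rank_eq_frk F H
    have hdiagonal : (Matrix.of fun i k => W (i, 0) k * W (i, 1) k) =
        Matrix.diagonal fun i => W (i, 0) i * W (i, 1) i := by
      ext i k
      by_cases hik : i = k
      · subst hik; simp
      · rw [Matrix.diagonal_apply_ne _ hik, Matrix.of_apply]
        by_contra hne
        exact zero_ne_one (hdisj i k (Ne.symm hik) 0 1
          ((hW _ _).1 (left_ne_zero_of_mul hne)) ((hW _ _).1 (right_ne_zero_of_mul hne)))
    have hdet : (Matrix.of fun i k => W (i, 0) k * W (i, 1) k).det ≠ 0 := by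
      rw [hdiagonal, Matrix.det_diagonal]
      exact Finset.prod_ne_zero_iff.2 fun i _ =>
        mul_ne_zero ((hW _ _).2 (hdiag i 0)) ((hW _ _).2 (hdiag i 1))
    have hle := rank_hadamard_submatrix_le W (fun i : Fin n => (i, 0)) (fun i => (i, 1))
    rwa [Matrix.rank_of_det_ne_zero hdet, Fintype.card_fin, hr] at hle
  exact ⟨hsq, Real.sqrt_le_iff.2 ⟨Nat.cast_nonneg _, by exact_mod_cast hsq⟩⟩
end
end

section
/- For every integer q ≥ 3 there exist a real δ with 0 < δ < e^{-2} and a natural number n₀ such that for every n ≥ n₀ there exists a q-LCC stencil H with group size t = ⌊δn⌋ whose visible rank satisfies vrk(H) ≤ n − n^{(q-2)/(q-1)} / log n. -/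
noncomputable section

theorem card_perm_mapsTo_le {γ : Type*} [Fintype γ] [DecidableEq γ] (A T : Finset γ) :
    ((Finset.univ.filter fun σ : Equiv.Perm γ => ∀ x ∈ T, σ x ∈ A).card : ℝ) ≤
      ((A.card : ℝ) / Fintype.card γ) ^ T.card * (Fintype.card (Equiv.Perm γ) : ℝ) := by
  induction T using Finset.induction_on with
  | empty => simp [Finset.card_univ]
  | insert b T hb ih =>
    set E := Finset.univ.filter fun σ : Equiv.Perm γ => ∀ x ∈ T, σ x ∈ A with hE
    have hsub : (Finset.univ.filter fun σ : Equiv.Perm γ => ∀ x ∈ insert b T, σ x ∈ A)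
        = E.filter fun σ => σ b ∈ A := by
      ext σ
      simp [hE, and_comm]
    rw [hsub]
    have hswap : ∀ c ∈ Tᶜ, (E.filter fun σ => σ c ∈ A).card = (E.filter fun σ => σ b ∈ A).card := by
      intro c hc
      have hmem : ∀ σ ∈ E, σ * Equiv.swap b c ∈ E := by
        intro σ hσ
        simp only [hE, Finset.mem_filter, Finset.mem_univ, true_and, Finset.mem_compl] at hσ hc ⊢
        intro x hx
        have h1 : x ≠ b := fun h => hb (h ▸ hx)
        have h2 : x ≠ c := fun h => hc (h ▸ hx)
        simpa [Equiv.swap_apply_of_ne_of_ne h1 h2] using hσ x hx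
      refine Finset.card_bij' (fun σ _ => σ * Equiv.swap b c) (fun σ _ => σ * Equiv.swap b c)
        ?_ ?_ ?_ ?_
      · intro σ hσ
        rw [Finset.mem_filter] at hσ ⊢
        exact ⟨hmem σ hσ.1, by simpa using hσ.2⟩
      · intro σ hσ
        rw [Finset.mem_filter] at hσ ⊢
        exact ⟨hmem σ hσ.1, by simpa using hσ.2⟩
      · intro σ _
        simp [mul_assoc]
      · intro σ _
        simp [mul_assoc]
    have hdouble : ∑ c ∈ Tᶜ, (E.filter fun σ => σ c ∈ A).card
        = ∑ σ ∈ E, (Tᶜ.filter fun c => σ c ∈ A).card :=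
      Finset.sum_card_bipartiteAbove_eq_sum_card_bipartiteBelow (fun c (σ : Equiv.Perm γ) => σ c ∈ A)
    have hcount : ∀ σ ∈ E, (Tᶜ.filter fun c => σ c ∈ A).card + T.card = A.card := by
      intro σ hσ
      have h1 : (Finset.univ.filter fun c => σ c ∈ A).card = A.card := by
        rw [← Finset.card_map σ.symm.toEmbedding (s := A)]
        congr 1
        ext c
        simp
      rw [← h1, ← Finset.card_union_of_disjoint]
      · congr 1
        ext c
        simp only [hE, Finset.mem_filter, Finset.mem_univ, true_and] at hσ
        simp only [Finset.mem_union, Finset.mem_filter, Finset.mem_compl, Finset.mem_univ, true_and]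
        have := hσ c
        tauto
      · rw [Finset.disjoint_left]
        intro c hc
        simpa using (Finset.mem_filter.1 hc).1
    have hT : Tᶜ.card + T.card = Fintype.card γ := Finset.card_compl_add_card T
    have hsum : Tᶜ.card * (E.filter fun σ => σ b ∈ A).card + E.card * T.card
        = E.card * A.card := by
      rw [Finset.sum_congr rfl hswap, Finset.sum_const, smul_eq_mul] at hdouble
      rw [hdouble, ← smul_eq_mul, ← Finset.sum_const, ← Finset.sum_add_distrib,
        Finset.sum_congr rfl hcount, Finset.sum_const, smul_eq_mul]
    have hle : (E.filter fun σ => σ b ∈ A).card ≤ E.card := Finset.card_filter_le _ _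
    have hkey : Fintype.card γ * (E.filter fun σ => σ b ∈ A).card ≤ A.card * E.card := by
      rw [← hT]
      nlinarith
    have hpos : (0 : ℝ) < Fintype.card γ := by
      exact_mod_cast Fintype.card_pos_iff.2 ⟨b⟩
    rw [Finset.card_insert_of_notMem hb, pow_succ]
    have hkey' : ((E.filter fun σ => σ b ∈ A).card : ℝ) ≤
        (A.card : ℝ) / Fintype.card γ * E.card := by
      rw [div_mul_eq_mul_div, le_div_iff₀ hpos, mul_comm]
      exact_mod_cast hkey
    calc _ ≤ (A.card : ℝ) / Fintype.card γ * E.card := hkey'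
      _ ≤ (A.card : ℝ) / Fintype.card γ *
          (((A.card : ℝ) / Fintype.card γ) ^ T.card * (Fintype.card (Equiv.Perm γ) : ℝ)) := by
        gcongr
      _ = _ := by ring

theorem exists_perm_of_fixedPointFree {α : Type*} [Finite α] (f : α → α) :
    ∃ τ : Equiv.Perm α, (∀ x, τ x = f x ∨ τ x = x) ∧
      ∀ x ∈ Function.periodicPts f, τ x = f x := by
  classical
  let g : α → α := fun x => if x ∈ Function.periodicPts f then f x else x
  have hb := Function.bijOn_periodicPts f
  have hg : Function.Injective g := by
    intro x y hxy
    simp only [g] at hxy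
    split_ifs at hxy with hx hy hy
    · exact hb.injOn hx hy hxy
    · exact absurd (hxy ▸ hb.mapsTo hx) hy
    · exact absurd (hxy ▸ hb.mapsTo hy) hx
    · exact hxy
  refine ⟨Equiv.ofBijective g (Finite.injective_iff_bijective.1 hg), fun x => ?_, fun x hx => ?_⟩
  · by_cases hx : x ∈ Function.periodicPts f <;> simp [g, hx]
  · simp [g, hx]

theorem exists_iterate_mem_periodicPts {α : Type*} [Finite α] (f : α → α) (x : α) :
    ∃ k, f^[k] x ∈ Function.periodicPts f := by
  obtain ⟨i, j, hij, h⟩ := Finite.exists_ne_map_eq_of_infinite fun k : ℕ => f^[k] x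
  wlog hlt : i < j generalizing i j
  · exact this j i hij.symm h.symm (by omega)
  refine ⟨i, j - i, by omega, ?_⟩
  change f^[j - i] (f^[i] x) = f^[i] x
  rw [← Function.iterate_add_apply, Nat.sub_add_cancel hlt.le]
  exact h.symm

/-- In a stencil whose only generalized diagonal is `σ`, every nonempty set of rows contains a row
that has no other star in the columns matched to that set. -/
theorem exists_isolated_row {α : Type*} [Finite α] {M : Matrix α α Bool}
    {σ : Equiv.Perm α} (hσ : ∀ i, M i (σ i) = true)
    (huniq : ∀ τ : Equiv.Perm α, (∀ i, M i (τ i) = true) → τ = σ)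
    {S : Finset α} (hS : S.Nonempty) :
    ∃ i ∈ S, ∀ j ∈ S, j ≠ i → M i (σ j) = false := by
  classical
  by_contra! hcon
  have hex : ∀ i, ∃ j, (i ∈ S → j ∈ S ∧ j ≠ i) ∧ M i (σ j) = true := by
    intro i
    by_cases hi : i ∈ S
    · obtain ⟨j, hj, hji, hM⟩ := hcon i hi
      exact ⟨j, fun _ => ⟨hj, hji⟩, by simpa using hM⟩
    · exact ⟨i, fun h => absurd h hi, hσ i⟩
  choose f hfS hfM using hex
  obtain ⟨τ, hτ, hτp⟩ := exists_perm_of_fixedPointFree f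
  have hτ1 : τ.trans σ = σ := by
    refine huniq _ fun i => ?_
    rcases hτ i with h | h
    · simpa [h] using hfM i
    · simpa [h] using hσ i
  obtain ⟨x, hx⟩ := hS
  obtain ⟨k, hk⟩ := exists_iterate_mem_periodicPts f x
  have hkS : f^[k] x ∈ S := by
    clear hk
    induction k with
    | zero => exact hx
    | succ k ih =>
      rw [Function.iterate_succ_apply']
      exact (hfS _ ih).1
  have h1 : σ (τ (f^[k] x)) = σ (f^[k] x) := DFunLike.congr_fun hτ1 _
  rw [hτp _ hk] at h1
  exact (hfS _ hkS).2 (σ.injective h1)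

theorem exists_triangular_set {α : Type*} [Fintype α] {M : Matrix α α Bool}
    {σ : Equiv.Perm α} (hσ : ∀ i, M i (σ i) = true)
    (huniq : ∀ τ : Equiv.Perm α, (∀ i, M i (τ i) = true) → τ = σ)
    {j : ℕ} (hj : j ≤ Fintype.card α) :
    ∃ S : Finset α, S.card + j = Fintype.card α ∧
      ∀ i ∉ S, ∀ l ∈ S, M i (σ l) = false := by
  classical
  induction j with
  | zero => exact ⟨Finset.univ, by simp [Finset.card_univ], by simp⟩
  | succ j ih =>
    obtain ⟨S, hcard, hS⟩ := ih (by omega)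
    obtain ⟨i, hi, hiS⟩ := exists_isolated_row hσ huniq (S := S)
      (Finset.card_pos.1 (by omega))
    refine ⟨S.erase i, ?_, fun k hk l hl => ?_⟩
    · have := Finset.card_erase_add_one hi
      omega
    · rw [Finset.mem_erase] at hl
      by_cases hki : k = i
      · exact hki ▸ hiS l hl.2 hl.1
      · exact hS k (fun h => hk (Finset.mem_erase.2 ⟨hki, h⟩)) l hl.2

/-- A stencil of large visible rank has, for every size `a`, a set of `a` columns containing the
supports of many rows. -/
theorem exists_dense_columns {α β : Type*} [Fintype β] [DecidableEq β]
    (H : Matrix α β Bool) {a : ℕ} (ha : a ≤ Fintype.card β)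
    (hva : Fintype.card β - vrk H ≤ a) :
    ∃ A : Finset β, ∃ R : Finset α, A.card = a ∧ R.card + (Fintype.card β - vrk H) = a ∧
      ∀ p ∈ R, ∀ k, H p k = true → k ∈ A := by
  classical
  have hle : ∀ k : ℕ, (∃ r : Fin k → α, ∃ c : Fin k → β,
      Function.Injective r ∧ Function.Injective c ∧
      VisFullRank (Matrix.of fun i j => H (r i) (c j))) → k ≤ Fintype.card β := by
    rintro k ⟨r, c, -, hc, -⟩
    simpa using Fintype.card_le_of_injective c hc
  have hmem : vrk H ∈ {k : ℕ | ∃ r : Fin k → α, ∃ c : Fin k → β,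
      Function.Injective r ∧ Function.Injective c ∧
      VisFullRank (Matrix.of fun i j => H (r i) (c j))} := by
    refine Nat.sSup_mem ⟨0, Fin.elim0, Fin.elim0, fun x => x.elim0, fun x => x.elim0, ?_⟩
      ⟨Fintype.card β, hle⟩
    exact ⟨1, fun i => i.elim0, fun τ _ => Subsingleton.elim _ _⟩
  have hv := hle _ hmem
  obtain ⟨r, c, hr, hc, σ, hσ, huniq⟩ := hmem
  obtain ⟨S, hcard, hS⟩ := exists_triangular_set hσ huniq
    (j := a - (Fintype.card β - vrk H)) (by simp; omega)
  rw [Fintype.card_fin] at hcard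
  refine ⟨(S.map (σ.toEmbedding.trans ⟨c, hc⟩))ᶜ, Sᶜ.map ⟨r, hr⟩, ?_, ?_, ?_⟩
  · rw [Finset.card_compl, Finset.card_map]
    omega
  · rw [Finset.card_map, Finset.card_compl, Fintype.card_fin]
    omega
  · intro p hp k hk
    obtain ⟨i, hi, rfl⟩ := Finset.mem_map.1 hp
    rw [Finset.mem_compl, Finset.mem_map]
    rintro ⟨l, hl, rfl⟩
    have := hS i (Finset.mem_compl.1 hi) l hl
    simp only [Matrix.of_apply] at this
    simp [this] at hk

theorem exists_sparse_family {m t q a b : ℕ} (slot : Fin t × Fin q ↪ Fin m)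
    (hnum : ((m + 1).choose a : ℝ) * ((a * t).choose b : ℝ) * ((a : ℝ) / m) ^ (q * b) < 1) :
    ∃ σ : Fin (m + 1) → Equiv.Perm (Fin m), ∀ A : Finset (Fin (m + 1)), A.card = a →
      ∀ R : Finset (Fin (m + 1) × Fin t), R.card = b → R ⊆ A ×ˢ Finset.univ →
        ∃ p ∈ R, ∃ l, p.1.succAbove (σ p.1 (slot (p.2, l))) ∉ A := by
  classical
  by_contra! hcon
  let Ω := Fin (m + 1) → Equiv.Perm (Fin m)
  let bad : Finset (Fin (m + 1)) → Finset (Fin (m + 1) × Fin t) → Finset Ω := fun A R =>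
    Finset.univ.filter fun σ => ∀ p ∈ R, ∀ l, p.1.succAbove (σ p.1 (slot (p.2, l))) ∈ A
  have hbad : ∀ A : Finset (Fin (m + 1)), A.card = a → ∀ R : Finset (Fin (m + 1) × Fin t),
      R.card = b → ((bad A R).card : ℝ) ≤ ((a : ℝ) / m) ^ (q * b) * (Fintype.card Ω : ℝ) := by
    intro A hA R hR
    let A' : Fin (m + 1) → Finset (Fin m) := fun i =>
      Finset.univ.filter fun x => i.succAbove x ∈ A
    let T : Fin (m + 1) → Finset (Fin m) := fun i =>
      ((R.filter fun p => p.1 = i) ×ˢ (Finset.univ : Finset (Fin q))).image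
        fun x => slot (x.1.2, x.2)
    have hA' : ∀ i, (A' i).card ≤ a := by
      intro i
      rw [← hA]
      refine Finset.card_le_card_of_injOn i.succAbove ?_ Fin.succAbove_right_injective.injOn
      intro x hx
      simpa [A'] using hx
    have hT : ∀ i, (T i).card = (R.filter fun p => p.1 = i).card * q := by
      intro i
      rw [Finset.card_image_of_injOn, Finset.card_product, Finset.card_univ, Fintype.card_fin]
      rintro ⟨⟨i₁, j₁⟩, l₁⟩ h₁ ⟨⟨i₂, j₂⟩, l₂⟩ h₂ h
      have h' := slot.injective h
      simp at h₁ h₂ h'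
      simp [h₁.2, h₂.2, h'.1, h'.2]
    have hbadpi : bad A R ⊆ Fintype.piFinset fun i =>
        Finset.univ.filter fun σ : Equiv.Perm (Fin m) => ∀ x ∈ T i, σ x ∈ A' i := by
      intro σ hσ
      have hσ' := (Finset.mem_filter.1 hσ).2
      refine Fintype.mem_piFinset.2 fun i => Finset.mem_filter.2 ⟨Finset.mem_univ _, fun x hx => ?_⟩
      simp only [T, Finset.mem_image, Finset.mem_product, Finset.mem_filter] at hx
      obtain ⟨⟨p, l⟩, ⟨⟨hp, hpi⟩, -⟩, rfl⟩ := hx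
      simp only [A', Finset.mem_filter, Finset.mem_univ, true_and]
      rw [← hpi]
      exact hσ' p hp l
    have hsum : ∑ i, (R.filter fun p => p.1 = i).card = b := by
      rw [← hR]
      exact (Finset.card_eq_sum_card_fiberwise fun p _ => Finset.mem_univ p.1).symm
    calc ((bad A R).card : ℝ)
        ≤ ((Fintype.piFinset fun i => Finset.univ.filter fun σ : Equiv.Perm (Fin m) =>
            ∀ x ∈ T i, σ x ∈ A' i).card : ℝ) := by
          exact_mod_cast Finset.card_le_card hbadpi
      _ = ∏ i, ((Finset.univ.filter fun σ : Equiv.Perm (Fin m) =>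
            ∀ x ∈ T i, σ x ∈ A' i).card : ℝ) := by
          rw [Fintype.card_piFinset]; push_cast; rfl
      _ ≤ ∏ i, (((a : ℝ) / m) ^ (T i).card * (Fintype.card (Equiv.Perm (Fin m)) : ℝ)) := by
          refine Finset.prod_le_prod (fun _ _ => by positivity) fun i _ => ?_
          refine le_trans (le_of_eq ?_) ((card_perm_mapsTo_le (A' i) (T i)).trans ?_)
          · congr!
          rw [Fintype.card_fin]
          have := hA' i
          gcongr
      _ = ((a : ℝ) / m) ^ (q * b) * (Fintype.card Ω : ℝ) := by
          rw [Finset.prod_mul_distrib, Finset.prod_pow_eq_pow_sum, Finset.sum_congr rfl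
            fun i _ => hT i, ← Finset.sum_mul, hsum, mul_comm b q, Fintype.card_pi]
          push_cast
          rfl
  have hcover : (Finset.univ : Finset Ω) ⊆
      (Finset.powersetCard a Finset.univ).biUnion fun A =>
        (Finset.powersetCard b (A ×ˢ Finset.univ)).biUnion fun R => bad A R := by
    intro σ _
    obtain ⟨A, hA, R, hR, hRA, h⟩ := hcon σ
    simp only [Finset.mem_biUnion, Finset.mem_powersetCard]
    exact ⟨A, ⟨Finset.subset_univ _, hA⟩, R, ⟨hRA, hR⟩, by simpa [bad] using h⟩
  have hΩ : (0 : ℝ) < Fintype.card Ω := by exact_mod_cast Fintype.card_pos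
  have hle : (Fintype.card Ω : ℝ) ≤ ((m + 1).choose a : ℝ) * (((a * t).choose b : ℝ) *
      (((a : ℝ) / m) ^ (q * b) * (Fintype.card Ω : ℝ))) := by
    calc (Fintype.card Ω : ℝ) ≤ ∑ A ∈ Finset.powersetCard a (Finset.univ : Finset (Fin (m + 1))),
          ∑ R ∈ Finset.powersetCard b (A ×ˢ (Finset.univ : Finset (Fin t))),
            ((bad A R).card : ℝ) := by
          rw [← Finset.card_univ]
          exact_mod_cast (Finset.card_le_card hcover).trans (Finset.card_biUnion_le.trans
            (Finset.sum_le_sum fun A _ => Finset.card_biUnion_le))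
      _ ≤ ∑ A ∈ Finset.powersetCard a (Finset.univ : Finset (Fin (m + 1))),
          (((a * t).choose b : ℝ) * (((a : ℝ) / m) ^ (q * b) * (Fintype.card Ω : ℝ))) := by
          refine Finset.sum_le_sum fun A hA => ?_
          have hA' := (Finset.mem_powersetCard.1 hA).2
          refine (Finset.sum_le_sum fun R hR =>
            hbad A hA' R (Finset.mem_powersetCard.1 hR).2).trans ?_
          rw [Finset.sum_const, Finset.card_powersetCard, Finset.card_product, hA',
            Finset.card_univ, Fintype.card_fin, nsmul_eq_mul]
      _ = _ := by
          rw [Finset.sum_const, Finset.card_powersetCard, Finset.card_univ, Fintype.card_fin,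
            nsmul_eq_mul]
  nlinarith

theorem choose_le_exp_mul_div_pow (N : ℕ) {k : ℕ} (hk : 0 < k) :
    (N.choose k : ℝ) ≤ (Real.exp 1 * N / k) ^ k := by
  have hk' : (0 : ℝ) < k := by exact_mod_cast hk
  have hf : (0 : ℝ) < (k.factorial : ℝ) := by exact_mod_cast k.factorial_pos
  have h1 : (k : ℝ) ^ k / k.factorial ≤ Real.exp 1 ^ k := by
    rw [Real.exp_one_pow]
    exact Real.pow_div_factorial_le_exp _ hk'.le k
  calc (N.choose k : ℝ) ≤ (N : ℝ) ^ k / k.factorial := Nat.choose_le_pow_div k N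
    _ = ((N : ℝ) / k) ^ k * ((k : ℝ) ^ k / k.factorial) := by
      rw [div_pow]
      field_simp
    _ ≤ ((N : ℝ) / k) ^ k * Real.exp 1 ^ k := by gcongr
    _ = _ := by rw [← mul_pow]; ring

theorem union_bound_lt_one {q m t a b : ℕ} {y : ℝ} (hq : 3 ≤ q) (hm : 1 ≤ m) (hy : 0 < y)
    (hyq : y ^ (q - 1) = ((m + 1 : ℕ) : ℝ)) (ha : 0 < a)
    (hya : ((m + 1 : ℕ) : ℝ) / y ≤ a) (hay : (a : ℝ) ≤ 2 * (((m + 1 : ℕ) : ℝ) / y))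
    (hba : b ≤ a) (hab : a ≤ 2 * b) (hlog : ((a : ℝ) - b) * Real.log y ≤ a / 2)
    (ht : (t : ℝ) ≤ Real.exp (-7) / (2 * 4 ^ q) * ((m + 1 : ℕ) : ℝ)) :
    ((m + 1).choose a : ℝ) * ((a * t).choose b : ℝ) * ((a : ℝ) / m) ^ (q * b) < 1 := by
  set n : ℝ := ((m + 1 : ℕ) : ℝ) with hn
  have hb : 0 < b := by omega
  have ha' : (0 : ℝ) < a := by exact_mod_cast ha
  have hb' : (0 : ℝ) < b := by exact_mod_cast hb
  have hm' : (1 : ℝ) ≤ m := by exact_mod_cast hm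
  have hnm : n = m + 1 := by simp [hn]
  have hab' : (a : ℝ) ≤ 2 * b := by exact_mod_cast hab
  have h1 : ((m + 1).choose a : ℝ) ≤ (Real.exp 1 * y) ^ a := by
    refine (choose_le_exp_mul_div_pow (m + 1) ha).trans ?_
    rw [mul_div_assoc]
    have : n / a ≤ y := by
      rw [div_le_iff₀ hy] at hya
      rw [div_le_iff₀ ha']
      linarith
    gcongr
  have h2 : ((a * t).choose b : ℝ) ≤ (Real.exp (-6) / 4 ^ q * n) ^ b := by
    refine (choose_le_exp_mul_div_pow (a * t) hb).trans ?_
    have h3 : ((a * t : ℕ) : ℝ) / b ≤ 2 * t := by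
      rw [div_le_iff₀ hb']
      push_cast
      nlinarith [(Nat.cast_nonneg t : (0 : ℝ) ≤ t)]
    have h4 : Real.exp (-6) = Real.exp 1 * Real.exp (-7) := by
      rw [← Real.exp_add]
      norm_num
    rw [mul_div_assoc]
    refine pow_le_pow_left₀ (by positivity) ?_ b
    calc Real.exp 1 * (((a * t : ℕ) : ℝ) / b)
        ≤ Real.exp 1 * (2 * (Real.exp (-7) / (2 * 4 ^ q) * n)) := by
          gcongr
          exact h3.trans (by linarith)
      _ = _ := by
          rw [h4]
          field_simp
  have h3 : ((a : ℝ) / m) ^ (q * b) ≤ ((4 / y) ^ q) ^ b := by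
    rw [pow_mul]
    have : (a : ℝ) / m ≤ 4 / y := by
      rw [← mul_div_assoc, le_div_iff₀ hy] at hay
      rw [div_le_div_iff₀ (by linarith) hy]
      linarith
    gcongr
  have hcomb : Real.exp (-6) / 4 ^ q * n * (4 / y) ^ q = Real.exp (-6) / y := by
    obtain ⟨r, rfl⟩ : ∃ r, q = r + 1 := ⟨q - 1, by omega⟩
    rw [Nat.add_sub_cancel] at hyq
    rw [← hyq, div_pow, pow_succ y r]
    field_simp
  have hexp : (Real.exp 1 * y) ^ a * (Real.exp (-6) / y) ^ b
      = Real.exp (a + ((a : ℝ) - b) * Real.log y - 6 * b) := by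
    have h5 : Real.exp 1 * y = Real.exp (1 + Real.log y) := by
      rw [Real.exp_add, Real.exp_log hy]
    have h6 : Real.exp (-6) / y = Real.exp (-6 - Real.log y) := by
      rw [Real.exp_sub, Real.exp_log hy]
    rw [h5, h6, ← Real.exp_nat_mul, ← Real.exp_nat_mul, ← Real.exp_add]
    congr 1
    ring
  calc ((m + 1).choose a : ℝ) * ((a * t).choose b : ℝ) * ((a : ℝ) / m) ^ (q * b)
      ≤ (Real.exp 1 * y) ^ a * (Real.exp (-6) / 4 ^ q * n) ^ b * ((4 / y) ^ q) ^ b := by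
        gcongr
    _ = (Real.exp 1 * y) ^ a * (Real.exp (-6) / y) ^ b := by
        rw [mul_assoc, ← mul_pow, hcomb]
    _ = Real.exp (a + ((a : ℝ) - b) * Real.log y - 6 * b) := hexp
    _ < 1 := by
        rw [Real.exp_lt_one_iff]
        linarith

theorem two_le_log_of_eight_le {n : ℕ} (hn : 8 ≤ n) : 2 ≤ Real.log n := by
  have hn' : (8 : ℝ) ≤ n := by exact_mod_cast hn
  rw [Real.le_log_iff_exp_le (by linarith)]
  have h : Real.exp 2 = Real.exp 1 ^ 2 := by rw [Real.exp_one_pow]; norm_num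
  rw [h]
  nlinarith [Real.exp_one_lt_d9, Real.exp_pos 1]

/-- The random `q`-LCC stencil of the probabilistic argument: the row `(i, j)` has stars at `i` and
at the images under `σ i` of the `j`-th block of slots. -/
def permStencil {m t q : ℕ} (slot : Fin t × Fin q ↪ Fin m)
    (σ : Fin (m + 1) → Equiv.Perm (Fin m)) : Matrix (Fin (m + 1) × Fin t) (Fin (m + 1)) Bool :=
  Matrix.of fun p k => decide (k = p.1 ∨ ∃ l, k = p.1.succAbove (σ p.1 (slot (p.2, l))))

theorem permStencil_eq_true {m t q : ℕ} {slot : Fin t × Fin q ↪ Fin m}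
    {σ : Fin (m + 1) → Equiv.Perm (Fin m)} {p : Fin (m + 1) × Fin t} {k : Fin (m + 1)} :
    permStencil slot σ p k = true ↔
      k = p.1 ∨ ∃ l, k = p.1.succAbove (σ p.1 (slot (p.2, l))) := by
  simp [permStencil]

theorem permStencil_disjoint {m t q : ℕ} {slot : Fin t × Fin q ↪ Fin m}
    {σ : Fin (m + 1) → Equiv.Perm (Fin m)} {i k : Fin (m + 1)} (hki : k ≠ i) {j j' : Fin t}
    (hj : permStencil slot σ (i, j) k = true) (hj' : permStencil slot σ (i, j') k = true) :
    j = j' := by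
  rw [permStencil_eq_true] at hj hj'
  obtain ⟨l, hl⟩ := hj.resolve_left hki
  obtain ⟨l', hl'⟩ := hj'.resolve_left hki
  have h := slot.injective ((σ i).injective (Fin.succAbove_right_injective (hl.symm.trans hl')))
  exact congrArg Prod.fst h

theorem permStencil_card_le {m t q : ℕ} (slot : Fin t × Fin q ↪ Fin m)
    (σ : Fin (m + 1) → Equiv.Perm (Fin m)) (p : Fin (m + 1) × Fin t) :
    (Finset.univ.filter fun k => permStencil slot σ p k = true).card ≤ q + 1 := by
  classical
  have hsub : (Finset.univ.filter fun k => permStencil slot σ p k = true) ⊆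
      insert p.1 (Finset.univ.image fun l => p.1.succAbove (σ p.1 (slot (p.2, l)))) := by
    intro k hk
    rw [Finset.mem_filter, permStencil_eq_true] at hk
    rcases hk.2 with h | ⟨l, h⟩ <;> simp [h]
  refine (Finset.card_le_card hsub).trans ((Finset.card_insert_le _ _).trans ?_)
  simpa using (Finset.card_image_le (s := (Finset.univ : Finset (Fin q))))

/-- For every `q ≥ 3` there exist `0 < δ < e⁻²` and `n₀` such that for all `n ≥ n₀`
there is a `q`-LCC stencil `H` (with group size `t = ⌊δn⌋`) with
`vrk H ≤ n - n^((q-2)/(q-1)) / log n`. -/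
theorem stmt2 (q : ℕ) (hq : 3 ≤ q) :
    ∃ δ : ℝ, 0 < δ ∧ δ < Real.exp (-2) ∧ ∃ n₀ : ℕ, ∀ n : ℕ, n₀ ≤ n →
      ∃ H : Matrix (Fin n × Fin ⌊δ * (n : ℝ)⌋₊) (Fin n) Bool,
        (∀ (i : Fin n) (j : Fin ⌊δ * (n : ℝ)⌋₊), H (i, j) i = true) ∧
        (∀ (i k : Fin n), k ≠ i →
          ∀ j j' : Fin ⌊δ * (n : ℝ)⌋₊, H (i, j) k = true → H (i, j') k = true → j = j') ∧
        (∀ p : Fin n × Fin ⌊δ * (n : ℝ)⌋₊,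
          (Finset.univ.filter fun k : Fin n => H p k = true).card ≤ q + 1) ∧
        (vrk H : ℝ) ≤ (n : ℝ) - (n : ℝ) ^ (((q : ℝ) - 2) / ((q : ℝ) - 1)) / Real.log n := by
  have h4q : (4 : ℝ) * q ≤ 4 ^ q := by
    obtain ⟨r, rfl⟩ : ∃ r, q = r + 1 := ⟨q - 1, by omega⟩
    have : r + 1 ≤ 4 ^ r := Nat.lt_pow_self (by norm_num)
    have : (r + 1 : ℝ) ≤ 4 ^ r := by exact_mod_cast this
    rw [pow_succ]
    push_cast
    linarith
  have hq' : (3 : ℝ) ≤ q := by exact_mod_cast hq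
  have hδ : Real.exp (-7) / (2 * 4 ^ q) ≤ Real.exp (-7) / (2 * (4 * q)) := by gcongr
  refine ⟨Real.exp (-7) / (2 * 4 ^ q), by positivity, ?_, 8, fun n hn => ?_⟩
  · calc Real.exp (-7) / (2 * 4 ^ q) ≤ Real.exp (-7) := by
          refine div_le_self (Real.exp_pos _).le ?_
          linarith
      _ < Real.exp (-2) := Real.exp_lt_exp.2 (by norm_num)
  obtain ⟨m, rfl⟩ : ∃ m, n = m + 1 := ⟨n - 1, by omega⟩
  set n : ℝ := ((m + 1 : ℕ) : ℝ) with hn_def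
  have hn8 : (8 : ℝ) ≤ n := by
    rw [hn_def]
    exact_mod_cast hn
  have hlogn : 2 ≤ Real.log n := two_le_log_of_eight_le hn
  set t := ⌊Real.exp (-7) / (2 * 4 ^ q) * n⌋₊
  have ht : (t : ℝ) ≤ Real.exp (-7) / (2 * 4 ^ q) * n := Nat.floor_le (by positivity)
  obtain ⟨slot⟩ : Nonempty (Fin t × Fin q ↪ Fin m) := by
    refine Function.Embedding.nonempty_of_card_le ?_
    rw [Fintype.card_prod, Fintype.card_fin, Fintype.card_fin, Fintype.card_fin]
    have h1 : (t : ℝ) * q ≤ m := by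
      have h2 : Real.exp (-7) ≤ 1 := Real.exp_le_one_iff.2 (by norm_num)
      have h3 : n = m + 1 := by simp [hn_def]
      calc (t : ℝ) * q ≤ Real.exp (-7) / (2 * (4 * q)) * n * q := by
            gcongr
            exact ht.trans (by gcongr)
        _ = Real.exp (-7) * n / 8 := by field_simp; norm_num
        _ ≤ m := by nlinarith
    exact_mod_cast h1
  set Y : ℝ := n ^ (((q : ℝ) - 2) / ((q : ℝ) - 1)) with hY
  set y : ℝ := n ^ (1 / ((q : ℝ) - 1)) with hy
  have hn0 : 0 < n := by linarith
  have hy0 : 0 < y := Real.rpow_pos_of_pos hn0 _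
  have hyq : y ^ (q - 1) = n := by
    rw [hy, ← Real.rpow_natCast, ← Real.rpow_mul hn0.le, Nat.cast_sub (by omega), Nat.cast_one,
      one_div_mul_cancel (by linarith), Real.rpow_one]
  have hYy : n / y = Y := by
    rw [hY, hy, div_eq_iff hy0.ne', ← Real.rpow_add hn0, ← add_div,
      show (q : ℝ) - 2 + 1 = q - 1 by ring, div_self (by linarith), Real.rpow_one]
  have hlogy : Real.log y = Real.log n / (q - 1) := by
    rw [hy, Real.log_rpow hn0]
    ring
  have hY1 : 1 ≤ Y := Real.one_le_rpow (by linarith)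
    (div_nonneg (by linarith) (by linarith))
  have hy1 : 1 ≤ y := Real.one_le_rpow (by linarith) (div_nonneg (by linarith) (by linarith))
  set s : ℝ := Y / Real.log n with hs
  have hs0 : 0 ≤ s := by positivity
  have hsY : s * Real.log n = Y := div_mul_cancel₀ _ (by linarith)
  have hs2 : 2 * s ≤ Y := by nlinarith
  set a := ⌈Y⌉₊
  have hYa : Y ≤ a := Nat.le_ceil Y
  have haY : (a : ℝ) < Y + 1 := Nat.ceil_lt_add_one (by linarith)
  have hfs : (⌊s⌋₊ : ℝ) ≤ s := Nat.floor_le hs0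
  have hfa : 2 * ⌊s⌋₊ ≤ a := by
    have : 2 * (⌊s⌋₊ : ℝ) ≤ a := by linarith
    exact_mod_cast this
  have ha0 : 0 < a := Nat.ceil_pos.2 (by linarith)
  have han : a ≤ m + 1 := by
    refine Nat.ceil_le.2 ?_
    rw [← hYy]
    exact div_le_self hn0.le hy1
  have hlog : ((a : ℝ) - (a - ⌊s⌋₊ : ℕ)) * Real.log y ≤ a / 2 := by
    rw [Nat.cast_sub (by omega), sub_sub_cancel, hlogy, mul_div_assoc',
      div_le_iff₀ (by linarith)]
    nlinarith
  obtain ⟨σ, hσ⟩ := exists_sparse_family (a := a) (b := a - ⌊s⌋₊) slot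
    (union_bound_lt_one hq (by omega) hy0 hyq ha0 (hYy.trans_le hYa) (by rw [hYy]; linarith)
      (Nat.sub_le _ _) (by omega) hlog ht)
  refine ⟨permStencil slot σ, fun i j => permStencil_eq_true.2 (Or.inl rfl),
    fun i k hki j j' => permStencil_disjoint hki, permStencil_card_le slot σ, ?_⟩
  by_contra! hv
  have hdef : m + 1 - vrk (permStencil slot σ) ≤ ⌊s⌋₊ := by
    rcases le_total (m + 1) (vrk (permStencil slot σ)) with h | h
    · omega
    · refine Nat.le_floor ?_
      rw [Nat.cast_sub h]
      linarith
  obtain ⟨A, R, hA, hR, hRA⟩ := exists_dense_columns (permStencil slot σ) (a := a)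
    (by simpa using han) (by simp only [Fintype.card_fin]; omega)
  rw [Fintype.card_fin] at hR
  obtain ⟨R', hR'R, hR'⟩ := Finset.exists_subset_card_eq (s := R) (n := a - ⌊s⌋₊) (by omega)
  obtain ⟨p, hp, l, hl⟩ := hσ A hA R' hR' fun p hp => Finset.mem_product.2
    ⟨hRA p (hR'R hp) _ (permStencil_eq_true.2 (Or.inl rfl)), Finset.mem_univ _⟩
  exact hl (hRA p (hR'R hp) _ (permStencil_eq_true.2 (Or.inr ⟨l, rfl⟩)))
end
end

section
/- Let M be an n × n stencil that is visibly full rank. Then there exist permutations π and σ of {1,…,n} such that the stencil N defined by N[i,j] = M[π(i), σ(j)] is upper triangular, i.e., N[i,i] = ⋆ for all i and N[i,j] = 0 whenever i > j. -/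
noncomputable section

/-- A self-map of a finite type agrees with a permutation on its periodic points, the permutation
being the identity elsewhere; a point whose forward orbit has no fixed point forces this permutation
to be nontrivial. -/
theorem exists_perm_ne_one_of_iterate_ne {α : Type*} [Finite α] (f : α → α) (x : α)
    (hx : ∀ k, f (f^[k] x) ≠ f^[k] x) :
    ∃ τ : Equiv.Perm α, τ ≠ 1 ∧ ∀ y, τ y = f y ∨ τ y = y := by
  classical
  obtain ⟨k, hk⟩ : ∃ k, f^[k] x ∈ Function.periodicPts f := by
    obtain ⟨a, b, hne, hab⟩ := Finite.exists_ne_map_eq_of_infinite fun k => f^[k] x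
    wlog hlt : a < b generalizing a b
    · exact this b a hne.symm hab.symm (by omega)
    refine ⟨a, Function.mk_mem_periodicPts (Nat.sub_pos_of_lt hlt) ?_⟩
    change f^[b - a] (f^[a] x) = f^[a] x
    rw [← Function.iterate_add_apply, Nat.sub_add_cancel hlt.le]
    exact hab.symm
  have hbij := Function.bijOn_periodicPts f
  have hinj : Function.Injective ((Function.periodicPts f).piecewise f id) := by
    rw [Set.injective_piecewise_iff]
    refine ⟨hbij.injOn, Function.injective_id.injOn, fun y hy z hz hyz => hz ?_⟩
    exact (show f y = z from hyz) ▸ hbij.mapsTo hy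
  refine ⟨Equiv.ofBijective _ (Finite.injective_iff_bijective.mp hinj), fun h => hx k ?_,
    fun y => ?_⟩
  · have := Equiv.congr_fun h (f^[k] x)
    simpa [Set.piecewise_eq_of_mem _ _ _ hk] using this
  · by_cases hy : y ∈ Function.periodicPts f <;> simp [hy]

/-- If `σ` is the only generalized diagonal of a finite stencil, then the off-diagonal ⋆'s,
with columns relabelled by `σ`, form an acyclic relation. -/
theorem wellFounded_of_unique_diagonal {α : Type*} [Finite α] {M : Matrix α α Bool}
    {σ : Equiv.Perm α} (hσ : ∀ i, M i (σ i) = true)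
    (huniq : ∀ τ : Equiv.Perm α, (∀ i, M i (τ i) = true) → τ = σ) :
    WellFounded fun i j => i ≠ j ∧ M i (σ j) = true := by
  classical
  rw [WellFounded.wellFounded_iff_has_min]
  intro S ⟨x, hx⟩
  by_contra! hS
  choose! p hpS hpne hp using hS
  have hmaps : Set.MapsTo (S.piecewise p id) S S := fun y hy => by
    simpa [Set.piecewise_eq_of_mem _ _ _ hy] using hpS y hy
  obtain ⟨τ, hτ, hτp⟩ := exists_perm_ne_one_of_iterate_ne (S.piecewise p id) x fun k => by
    have hk := hmaps.iterate k hx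
    rw [Set.piecewise_eq_of_mem _ _ _ hk]
    exact hpne _ hk
  have hM : ∀ y, M (τ y) (σ y) = true := fun y => by
    rcases hτp y with h | h <;> rw [h]
    · by_cases hy : y ∈ S
      · simpa [hy] using hp y hy
      · simpa [hy] using hσ y
    · exact hσ y
  have h := huniq (σ * τ⁻¹) fun i => by simpa using hM (τ⁻¹ i)
  exact hτ (by simpa using h)

/-- Every visibly full rank square stencil is permutationally equivalent to an
upper triangular stencil. -/
theorem stmt6 (n : ℕ) (M : Matrix (Fin n) (Fin n) Bool) (h : VisFullRank M) :
    ∃ π σ : Equiv.Perm (Fin n),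
      (∀ i, M (π i) (σ i) = true) ∧ ∀ i j, j < i → M (π i) (σ j) = false := by
  obtain ⟨σ, hσ, huniq⟩ := h
  have hwf := wellFounded_of_unique_diagonal hσ huniq
  let : IsWellFounded (Fin n) fun i j => i ≠ j ∧ M i (σ j) = true := ⟨hwf⟩
  let r := IsWellFounded.rank fun i j => i ≠ j ∧ M i (σ j) = true
  refine ⟨Tuple.sort r, σ * Tuple.sort r, fun i => hσ _, fun i j hji => ?_⟩
  by_contra hne
  rw [Bool.not_eq_false] at hne
  exact (Tuple.monotone_sort r hji.le).not_gt
    (IsWellFounded.rank_lt_of_rel ⟨(Tuple.sort r).injective.ne hji.ne', hne⟩)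
end
end

section
/- Let M be an n × n stencil (with n ≥ 1) that is visibly full rank. Then M has a row containing exactly one ⋆. -/
noncomputable section

/-- A self-map of a nonempty finite type has a periodic point. -/
theorem nonempty_periodicPts_of_finite {α : Type*} [Finite α] [Nonempty α] (f : α → α) :
    (Function.periodicPts f).Nonempty := by
  obtain ⟨x⟩ := ‹Nonempty α›
  obtain ⟨a, b, hab, h⟩ := Finite.exists_ne_map_eq_of_infinite fun k : ℕ => f^[k] x
  wlog hlt : a < b generalizing a b
  · exact this b a hab.symm h.symm (by omega)
  refine ⟨f^[a] x, Function.mk_mem_periodicPts (Nat.sub_pos_of_lt hlt) ?_⟩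
  change f^[b - a] (f^[a] x) = f^[a] x
  rw [← Function.iterate_add_apply, Nat.sub_add_cancel hlt.le]
  exact h.symm

/-- A fixed-point-free self-map of a nonempty finite type agrees with some nontrivial permutation
on the points which that permutation moves. -/
theorem exists_perm_ne_one_forall_eq_or_eq {α : Type*} [Finite α] [Nonempty α] (f : α → α)
    (hf : ∀ x, f x ≠ x) :
    ∃ τ : Equiv.Perm α, τ ≠ 1 ∧ ∀ x, τ x = x ∨ τ x = f x := by
  classical
  set s := Function.periodicPts f
  have hs : Set.BijOn f s s := Function.bijOn_periodicPts f
  have hinj : Function.Injective (s.piecewise f id) :=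
    (Set.injective_piecewise_iff s).2 ⟨hs.injOn, Function.injective_id.injOn, fun x hx y hy hxy =>
      hy ((show f x = y from hxy) ▸ hs.mapsTo hx)⟩
  refine ⟨Equiv.ofBijective _ (Finite.injective_iff_bijective.1 hinj), fun hτ => ?_, fun x => ?_⟩
  · obtain ⟨x, hx⟩ := nonempty_periodicPts_of_finite f
    have h := Equiv.congr_fun hτ x
    rw [Equiv.ofBijective_apply, Set.piecewise_eq_of_mem _ _ _ hx] at h
    exact hf x h
  · by_cases hx : x ∈ s
    · exact .inr (Set.piecewise_eq_of_mem _ _ _ hx)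
    · exact .inl (Set.piecewise_eq_of_notMem _ _ _ hx)

/-- A visibly full rank square stencil (with `n ≥ 1`) has a row with exactly one ⋆. -/
theorem stmt7 (n : ℕ) (hn : 1 ≤ n) (M : Matrix (Fin n) (Fin n) Bool)
    (h : VisFullRank M) :
    ∃ i : Fin n, ∃! j : Fin n, M i j = true := by
  obtain ⟨σ, hσ, huniq⟩ := h
  have : Nonempty (Fin n) := ⟨⟨0, hn⟩⟩
  by_contra! hM
  have hex (i : Fin n) : ∃ k, k ≠ i ∧ M i (σ k) = true := by
    by_contra! hi
    refine hM i ⟨σ i, hσ i, fun j hj => ?_⟩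
    by_contra hne
    refine hi (σ.symm j) (fun h => hne ?_) (by simpa using hj)
    rw [← h, Equiv.apply_symm_apply]
  choose f hf hMf using hex
  obtain ⟨τ, hτ, hτf⟩ := exists_perm_ne_one_forall_eq_or_eq f hf
  refine hτ (mul_eq_left.1 (huniq (σ * τ) fun i => ?_))
  rw [Equiv.Perm.mul_apply]
  rcases hτf i with h | h <;> rw [h]
  exacts [hσ i, hMf i]
end
end

section
/- Let H be an m × n stencil in which each row has at most d entries equal to 0, and let F be a field with |F| ≥ n. Then rk_F(H) ≤ d + 1. -/
noncomputable section

open Polynomial in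
/-- A matrix whose rows evaluate polynomials of degree at most `d` has rank at most `d + 1`. -/
theorem Matrix.rank_of_eval_le {α β F : Type*} [Fintype β] [Field F] {d : ℕ} (p : α → F[X])
    (hp : ∀ i, (p i).natDegree ≤ d) (x : β → F) :
    (Matrix.of fun i j => (p i).eval (x j)).rank ≤ d + 1 := by
  have hfactor : (Matrix.of fun i j => (p i).eval (x j)) =
      (Matrix.of fun i (k : Fin (d + 1)) => (p i).coeff k) *
        Matrix.of fun (k : Fin (d + 1)) j => x j ^ (k : ℕ) := by
    ext i j
    simp only [Matrix.mul_apply, Matrix.of_apply]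
    rw [eval_eq_sum_range' (Nat.lt_succ_of_le (hp i)), Finset.sum_range]
  rw [hfactor]
  exact (Matrix.rank_mul_le_left _ _).trans ((Matrix.rank_le_card_width _).trans (by simp))

/-- If each row of `H` has at most `d` zeros and `|F| ≥ n`, then `rk_F(H) ≤ d + 1`. -/
theorem stmt9 (m n d : ℕ) (H : Matrix (Fin m) (Fin n) Bool)
    (hrow : ∀ i : Fin m, (Finset.univ.filter fun j : Fin n => H i j = false).card ≤ d)
    (F : Type*) [Field F] (hF : (n : Cardinal) ≤ Cardinal.mk F) :
    frk F H ≤ d + 1 := by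
  obtain ⟨x⟩ : Nonempty (Fin n ↪ F) := by
    rw [← Cardinal.lift_mk_le']
    simpa using hF
  set p : Fin m → Polynomial F := fun i =>
    ∏ k with H i k = false, (Polynomial.X - Polynomial.C (x k)) with hp
  have hwitness : IsWitness H (Matrix.of fun i j => (p i).eval (x j)) := fun i j => by
    simp [hp, Polynomial.eval_prod, Finset.prod_eq_zero_iff, sub_eq_zero]
  have hdegree (i : Fin m) : (p i).natDegree ≤ d := by
    simpa [hp] using hrow i
  have hle : frk F H ≤ (Matrix.of fun i j => (p i).eval (x j)).rank :=
    Nat.sInf_le ⟨_, hwitness, rfl⟩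
  exact hle.trans (Matrix.rank_of_eval_le p hdegree x)
end
end

section
/- Let 𝒮 be a symmetric spanoid over [n] determined by sets S₁, …, S_m ⊆ [n], and let H be the m × n stencil defined by H[i,j] = ⋆ iff j ∈ S_i. Then for every set C ⊆ [n] of columns of H, the columns C are visibly independent in H if and only if span_𝒮([n] \ C) = [n]. Moreover, vrk(H) + rank(𝒮) = n. -/
noncomputable section

/-- The span of `T` in the symmetric spanoid determined by the sets `S j`:
the smallest superset of `T` closed under the rules `S j \ {i} → i` for `i ∈ S j`. -/
def spanS {m n : ℕ} (S : Fin m → Finset (Fin n)) (T : Set (Fin n)) : Set (Fin n) :=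
  ⋂₀ {T' : Set (Fin n) | T ⊆ T' ∧
    ∀ j : Fin m, ∀ i ∈ S j, ((S j : Set (Fin n)) \ {i}) ⊆ T' → i ∈ T'}

/-- The rank of the symmetric spanoid determined by the sets `S j`. -/
def spanoidRank {m n : ℕ} (S : Fin m → Finset (Fin n)) : ℕ :=
  sInf {k : ℕ | ∃ T : Finset (Fin n), T.card = k ∧ spanS S ↑T = Set.univ}

/-- A set `C` of columns of `H` is visibly independent if some `|C| × |C|`
sub-stencil supported on the columns `C` is visibly full rank. -/
def VisiblyIndep {m n : ℕ} (H : Matrix (Fin m) (Fin n) Bool) (C : Finset (Fin n)) : Prop :=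
  ∃ (r : Fin C.card → Fin m) (c : Fin C.card → Fin n),
    Function.Injective r ∧ Function.Injective c ∧ (∀ i, c i ∈ C) ∧
    VisFullRank (Matrix.of fun i j => H (r i) (c j))

lemma subset_spanS {m n : ℕ} (S : Fin m → Finset (Fin n)) (T : Set (Fin n)) :
    T ⊆ spanS S T :=
  Set.subset_sInter fun _ h => h.1

lemma spanS_mono {m n : ℕ} (S : Fin m → Finset (Fin n)) {T U : Set (Fin n)} (h : T ⊆ U) :
    spanS S T ⊆ spanS S U :=
  Set.sInter_subset_sInter fun _ hV => ⟨h.trans hV.1, hV.2⟩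

lemma spanS_closed {m n : ℕ} (S : Fin m → Finset (Fin n)) (T : Set (Fin n)) (j : Fin m)
    (i : Fin n) (hi : i ∈ S j) (h : (S j : Set (Fin n)) \ {i} ⊆ spanS S T) :
    i ∈ spanS S T := by
  rintro U ⟨hTU, hU⟩
  exact hU j i hi (h.trans (Set.sInter_subset_of_mem ⟨hTU, hU⟩))

/-- A set that spans everything but is not everything is not closed. -/
lemma exists_rule_of_spanS_eq_univ {m n : ℕ} (S : Fin m → Finset (Fin n)) {T : Set (Fin n)}
    (h : spanS S T = Set.univ) (hT : T ≠ Set.univ) :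
    ∃ j, ∃ i ∈ S j, (S j : Set (Fin n)) \ {i} ⊆ T ∧ i ∉ T := by
  by_contra! hclosed
  have hsub : spanS S T ⊆ T := Set.sInter_subset_of_mem ⟨subset_rfl, hclosed⟩
  exact hT (Set.univ_subset_iff.mp (h ▸ hsub))

/-- A self-map of a finite type that moves some point, and moves the image of every moved
point, has a nontrivial cycle, which extends to a permutation by the identity. -/
lemma exists_perm_ne_one_of_no_fixed_point {α : Type*} [Finite α] (h : α → α) {a : α}
    (ha : h a ≠ a) (hmoved : ∀ x, h x ≠ x → h (h x) ≠ h x) :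
    ∃ τ : Equiv.Perm α, τ ≠ 1 ∧ ∀ x, τ x = x ∨ τ x = h x := by
  classical
  let g : α → α := fun x => if x ∈ Function.periodicPts h then h x else x
  have hbij := Function.bijOn_periodicPts h
  have hg : Function.Injective g := by
    intro x y hxy
    by_cases hx : x ∈ Function.periodicPts h <;> by_cases hy : y ∈ Function.periodicPts h <;>
      simp only [g, hx, hy, if_true, if_false] at hxy
    · exact hbij.injOn hx hy hxy
    · exact absurd (hxy ▸ hbij.mapsTo hx) hy
    · exact absurd (hxy ▸ hbij.mapsTo hy) hx
    · exact hxy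
  have hiter : ∀ k, h (h^[k] a) ≠ h^[k] a := by
    intro k
    induction k with
    | zero => exact ha
    | succ k ih =>
      rw [Function.iterate_succ_apply']
      exact hmoved _ ih
  obtain ⟨k, l, hkl, heq⟩ : ∃ k l : ℕ, k < l ∧ h^[k] a = h^[l] a := by
    obtain ⟨k, l, hne, heq⟩ := Finite.exists_ne_map_eq_of_infinite fun k : ℕ => h^[k] a
    rcases lt_or_gt_of_ne hne with hlt | hlt
    · exact ⟨k, l, hlt, heq⟩
    · exact ⟨l, k, hlt, heq.symm⟩
  have hper : h^[k] a ∈ Function.periodicPts h := by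
    refine ⟨l - k, by omega, ?_⟩
    rw [Function.IsPeriodicPt, Function.IsFixedPt, ← Function.iterate_add_apply,
      Nat.sub_add_cancel hkl.le, heq]
  refine ⟨Equiv.ofBijective g (Finite.injective_iff_bijective.mp hg), fun h1 => ?_, fun x => ?_⟩
  · have := congrArg (fun σ : Equiv.Perm α => σ (h^[k] a)) h1
    simp only [Equiv.ofBijective_apply, g, hper, if_true, Equiv.Perm.one_apply] at this
    exact hiter k this
  · by_cases hx : x ∈ Function.periodicPts h <;> simp [g, hx]

/-- The columns outside a visibly full rank sub-stencil span everything. -/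
lemma spanS_compl_range_of_visFullRank {m n : ℕ} {S : Fin m → Finset (Fin n)}
    {H : Matrix (Fin m) (Fin n) Bool} (hH : ∀ i j, H i j = true ↔ j ∈ S i)
    {α : Type*} [Finite α] (r : α → Fin m) (c : α → Fin n)
    (hvis : VisFullRank (Matrix.of fun i j => H (r i) (c j))) :
    spanS S (Set.range c)ᶜ = Set.univ := by
  classical
  obtain ⟨σ, hσ, huniq⟩ := hvis
  simp only [Matrix.of_apply, hH] at hσ huniq
  by_contra hne
  obtain ⟨x₀, hx₀⟩ := (Set.ne_univ_iff_exists_notMem _).mp hne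
  have hcol : ∀ x ∉ spanS S (Set.range c)ᶜ, ∃ a, c (σ a) = x := by
    intro x hx
    obtain ⟨b, rfl⟩ := not_not.mp fun hr => hx (subset_spanS S _ hr)
    exact ⟨σ.symm b, by simp⟩
  have hstep : ∀ a, ∃ b, c (σ a) ∉ spanS S (Set.range c)ᶜ →
      b ≠ a ∧ c (σ b) ∉ spanS S (Set.range c)ᶜ ∧ c (σ b) ∈ S (r a) := by
    intro a
    by_cases ha : c (σ a) ∈ spanS S (Set.range c)ᶜ
    · exact ⟨a, fun h => absurd ha h⟩
    · have hns := fun h => ha (spanS_closed S _ (r a) _ (hσ a) h)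
      obtain ⟨x, ⟨hxS, hxa⟩, hx⟩ := Set.not_subset.mp hns
      obtain ⟨b, rfl⟩ := hcol x hx
      exact ⟨b, fun _ => ⟨fun hba => hxa (by simp [hba]), hx, hxS⟩⟩
  choose h₀ hh₀ using hstep
  let h : α → α := fun a => if c (σ a) ∈ spanS S (Set.range c)ᶜ then a else h₀ a
  have hpos : ∀ {a}, c (σ a) ∈ spanS S (Set.range c)ᶜ → h a = a := fun ha => if_pos ha
  have hneg : ∀ {a}, c (σ a) ∉ spanS S (Set.range c)ᶜ → h a = h₀ a := fun ha => if_neg ha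
  have hmove : ∀ {a}, c (σ a) ∉ spanS S (Set.range c)ᶜ → h a ≠ a := fun ha => by
    rw [hneg ha]
    exact (hh₀ _ ha).1
  obtain ⟨a₀, rfl⟩ := hcol x₀ hx₀
  obtain ⟨τ, hτ, hτh⟩ := exists_perm_ne_one_of_no_fixed_point h (hmove hx₀) fun a ha => by
    have ha' : c (σ a) ∉ spanS S (Set.range c)ᶜ := fun h' => ha (hpos h')
    apply hmove
    rw [hneg ha']
    exact (hh₀ a ha').2.1
  refine hτ (mul_eq_left.mp (huniq (σ * τ) fun a => ?_))
  rw [Equiv.Perm.mul_apply]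
  rcases hτh a with h1 | h1
  · rw [h1]
    exact hσ a
  · rw [h1]
    by_cases ha : c (σ a) ∈ spanS S (Set.range c)ᶜ
    · rw [hpos ha]
      exact hσ a
    · rw [hneg ha]
      exact (hh₀ a ha).2.2

/-- A stencil with a full diagonal and no entries above it is visibly full rank. -/
lemma visFullRank_of_lowerTriangular {k : ℕ} {M : Matrix (Fin k) (Fin k) Bool}
    (hdiag : ∀ i, M i i = true) (htri : ∀ i j, i < j → M i j = false) : VisFullRank M := by
  refine ⟨1, hdiag, fun σ hσ => Equiv.ext fun i => ?_⟩
  have hle : ∀ i, σ i ≤ i := fun i => not_lt.mp fun hlt => by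
    simpa [htri _ _ hlt] using hσ i
  have hsum : ∑ i, (σ i : ℕ) = ∑ i : Fin k, (i : ℕ) := Equiv.sum_comp σ fun i : Fin k => (i : ℕ)
  have := (Finset.sum_eq_sum_iff_of_le fun i _ => Fin.le_def.mp (hle i)).mp hsum i
    (Finset.mem_univ i)
  exact Fin.ext this

/-- Peeling off the columns outside a spanning set one at a time yields a triangular
sub-stencil. -/
lemma exists_lowerTriangular_of_spanS {m n : ℕ} {S : Fin m → Finset (Fin n)}
    {H : Matrix (Fin m) (Fin n) Bool} (hH : ∀ i j, H i j = true ↔ j ∈ S i) (k : ℕ)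
    (C : Finset (Fin n)) (hk : C.card = k) (hC : spanS S (↑C)ᶜ = Set.univ) :
    ∃ (r : Fin k → Fin m) (c : Fin k → Fin n), Function.Injective c ∧ (∀ i, c i ∈ C) ∧
      (∀ i, H (r i) (c i) = true) ∧ ∀ i j, i < j → H (r i) (c j) = false := by
  induction k generalizing C with
  | zero => exact ⟨Fin.elim0, Fin.elim0, fun i => i.elim0, fun i => i.elim0, fun i => i.elim0,
      fun i => i.elim0⟩
  | succ k ih =>
    obtain ⟨x, hx⟩ := Finset.card_pos.mp (by omega : 0 < C.card)
    obtain ⟨j, i, hij, hsub, hi⟩ := exists_rule_of_spanS_eq_univ S hC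
      ((Set.ne_univ_iff_exists_notMem _).mpr ⟨x, by simpa using hx⟩)
    have hiC : i ∈ C := by simpa using hi
    obtain ⟨r, c, hc, hcC, hdiag, htri⟩ := ih (C.erase i)
      (by rw [Finset.card_erase_of_mem hiC, hk, Nat.add_sub_cancel])
      (Set.univ_subset_iff.mp (hC ▸ spanS_mono S
        (Set.compl_subset_compl.mpr (Finset.coe_subset.mpr (Finset.erase_subset i C)))))
    have hci : ∀ a, c a ≠ i ∧ c a ∈ C := fun a => Finset.mem_erase.mp (hcC a)
    refine ⟨Fin.cons j r, Fin.cons i c, Fin.cons_injective_iff.mpr ⟨?_, hc⟩, ?_, ?_, ?_⟩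
    · rintro ⟨a, ha⟩
      exact (hci a).1 ha
    · exact Fin.cases hiC fun a => (hci a).2
    · exact Fin.cases ((hH j i).mpr hij) hdiag
    · intro a b
      refine Fin.cases ?_ (fun b => ?_) b
      · intro h
        exact absurd h (Fin.not_lt_zero a)
      · refine Fin.cases (fun _ => ?_) (fun a hab => htri a b (Fin.succ_lt_succ_iff.mp hab)) a
        simp only [Fin.cons_zero, Fin.cons_succ, Bool.eq_false_iff, ne_eq, hH]
        intro hS
        exact hsub ⟨hS, (hci b).1⟩ (hci b).2

lemma visiblyIndep_of_spanS {m n : ℕ} {S : Fin m → Finset (Fin n)}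
    {H : Matrix (Fin m) (Fin n) Bool} (hH : ∀ i j, H i j = true ↔ j ∈ S i)
    (C : Finset (Fin n)) (hC : spanS S (↑C)ᶜ = Set.univ) : VisiblyIndep H C := by
  obtain ⟨r, c, hc, hcC, hdiag, htri⟩ := exists_lowerTriangular_of_spanS hH _ C rfl hC
  refine ⟨r, c, fun a b hab => ?_, hc, hcC, visFullRank_of_lowerTriangular hdiag htri⟩
  rcases lt_trichotomy a b with hlt | heq | hlt
  · simpa [hab, hdiag] using htri a b hlt
  · exact heq
  · simpa [← hab, hdiag] using htri b a hlt

/-- Rank-nullity between a symmetric spanoid and its canonical stencil: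
columns `C` are visibly independent iff `[n] \ C` spans `[n]`, and
`vrk H + rank 𝒮 = n`. -/
theorem stmt10 (m n : ℕ) (S : Fin m → Finset (Fin n))
    (H : Matrix (Fin m) (Fin n) Bool) (hH : ∀ i j, H i j = true ↔ j ∈ S i) :
    (∀ C : Finset (Fin n), VisiblyIndep H C ↔ spanS S (↑C)ᶜ = Set.univ) ∧
    vrk H + spanoidRank S = n := by
  have hcompl : ∀ {k : ℕ} (r : Fin k → Fin m) (c : Fin k → Fin n),
      VisFullRank (Matrix.of fun i j => H (r i) (c j)) →
      spanS S (↑(Finset.univ.image c))ᶜ = Set.univ := fun r c hv => by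
    simpa using spanS_compl_range_of_visFullRank hH r c hv
  refine ⟨fun C => ⟨?_, visiblyIndep_of_spanS hH C⟩, ?_⟩
  · rintro ⟨r, c, -, hc, hcC, hv⟩
    have himage : Finset.univ.image c = C :=
      Finset.eq_of_subset_of_card_le (Finset.image_subset_iff.mpr fun i _ => hcC i)
        (by simp [Finset.card_image_of_injective _ hc])
    exact himage ▸ hcompl r c hv
  · have hbdd : BddAbove {k : ℕ | ∃ r : Fin k → Fin m, ∃ c : Fin k → Fin n,
        Function.Injective r ∧ Function.Injective c ∧
        VisFullRank (Matrix.of fun i j => H (r i) (c j))} := by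
      refine ⟨n, ?_⟩
      rintro k ⟨r, c, -, hc, -⟩
      simpa using Fintype.card_le_of_injective c hc
    have hfull : spanS S (↑(Finset.univ : Finset (Fin n))) = Set.univ :=
      Set.univ_subset_iff.mp (by simpa using subset_spanS S Set.univ)
    have hempty : VisiblyIndep H ∅ := visiblyIndep_of_spanS hH ∅ (by simpa using hfull)
    obtain ⟨r₀, c₀, hr₀, hc₀, -, hv₀⟩ := hempty
    obtain ⟨r, c, -, hc, hv⟩ := Nat.sSup_mem (by exact ⟨_, r₀, c₀, hr₀, hc₀, hv₀⟩) hbdd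
    obtain ⟨T, hT, hspan⟩ : spanoidRank S ∈ {k : ℕ | ∃ T : Finset (Fin n),
        T.card = k ∧ spanS S ↑T = Set.univ} := Nat.sInf_mem ⟨_, _, rfl, hfull⟩
    obtain ⟨r', c', hr', hc', -, hv'⟩ := visiblyIndep_of_spanS hH Tᶜ (by simpa using hspan)
    have hlower : Tᶜ.card ≤ vrk H := le_csSup hbdd ⟨r', c', hr', hc', hv'⟩
    have hupper : spanoidRank S ≤ (Finset.univ.image c)ᶜ.card :=
      Nat.sInf_le ⟨_, rfl, by simpa using hcompl r c hv⟩
    have hle : vrk H ≤ n := by simpa [vrk] using Fintype.card_le_of_injective c hc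
    rw [Finset.card_compl, Fintype.card_fin] at hlower hupper
    rw [Finset.card_image_of_injective _ hc, Finset.card_univ, Fintype.card_fin] at hupper
    change spanoidRank S ≤ n - vrk H at hupper
    omega
end
end

section
/- If A and B are n × n stencils that are each visibly full rank, then their tensor product A ⊗ B (an n² × n² stencil) is visibly full rank. -/
noncomputable section

/-- If `f` and `g` have all fibres of the same size `k` and every pair `(f x, g x)` is a `⋆` of a
stencil with the unique generalized diagonal `σ`, then `g = σ ∘ f`. This is Birkhoff's theorem
applied to the normalized matrix counting the pairs `(f x, g x)`. -/
theorem eq_perm_apply_of_fiber_card_eq {α γ : Type*} [Fintype α] [DecidableEq α] [Fintype γ]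
    {M : Matrix α α Bool} {σ : Equiv.Perm α}
    (hσ : ∀ p : Equiv.Perm α, (∀ i, M i (p i) = true) → p = σ) {f g : γ → α} {k : ℕ}
    (hf : ∀ i, (Finset.univ.filter fun x => f x = i).card = k)
    (hg : ∀ j, (Finset.univ.filter fun x => g x = j).card = k)
    (hM : ∀ x, M (f x) (g x) = true) (x : γ) : g x = σ (f x) := by
  have hk : (k : ℝ) ≠ 0 := by
    rw [← hf (f x), Nat.cast_ne_zero]
    exact Finset.card_ne_zero_of_mem (a := x) (by simp)
  let N : α → α → ℕ := fun i j => (Finset.univ.filter fun x => f x = i ∧ g x = j).card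
  have hrow (i : α) : ∑ j, N i j = k := by
    rw [← hf i, Finset.card_eq_sum_card_fiberwise (f := g) (t := Finset.univ) (by simp)]
    simp only [N, Finset.filter_filter]
  have hcol (j : α) : ∑ i, N i j = k := by
    rw [← hg j, Finset.card_eq_sum_card_fiberwise (f := f) (t := Finset.univ) (by simp)]
    simp only [N, Finset.filter_filter, and_comm]
  let D : Matrix α α ℝ := Matrix.of fun i j => (N i j : ℝ) / k
  have hD : D ∈ doublyStochastic ℝ α := by
    refine mem_doublyStochastic_iff_sum.2 ⟨fun i j => by simp only [D, Matrix.of_apply]; positivity,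
      fun i => ?_, fun j => ?_⟩
    · simp only [D, Matrix.of_apply, ← Finset.sum_div]
      rw [← Nat.cast_sum, hrow, div_self hk]
    · simp only [D, Matrix.of_apply, ← Finset.sum_div]
      rw [← Nat.cast_sum, hcol, div_self hk]
  obtain ⟨w, hw, -, hwD⟩ := exists_eq_sum_perm_of_mem_doublyStochastic hD
  have hentry (i j : α) : D i j = ∑ p, w p * if p i = j then 1 else 0 := by
    rw [← hwD]
    simp [Matrix.sum_apply, Equiv.Perm.permMatrix, PEquiv.toMatrix_apply, eq_comm]
  have hsupp (p : Equiv.Perm α) (hp : w p ≠ 0) : p = σ := by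
    refine hσ p fun i => ?_
    have hle : w p ≤ D i (p i) := by
      rw [hentry]
      simpa using Finset.single_le_sum
        (f := fun q : Equiv.Perm α => w q * if q i = p i then (1 : ℝ) else 0)
        (fun q _ => mul_nonneg (hw q) (by split_ifs <;> norm_num)) (Finset.mem_univ p)
    have hN : N i (p i) ≠ 0 := by
      intro h0
      simp only [D, Matrix.of_apply, h0, Nat.cast_zero, zero_div] at hle
      exact hp (le_antisymm hle (hw p))
    obtain ⟨y, hy⟩ := Finset.card_ne_zero.1 hN
    obtain ⟨hy₁, hy₂⟩ := (Finset.mem_filter.1 hy).2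
    simpa only [hy₁, hy₂] using hM y
  by_contra hne
  have hzero : D (f x) (g x) = 0 := by
    rw [hentry]
    refine Finset.sum_eq_zero fun p _ => ?_
    by_cases hp : w p = 0
    · simp [hp]
    · rw [hsupp p hp, if_neg (Ne.symm hne), mul_zero]
  have hN : N (f x) (g x) ≠ 0 := Finset.card_ne_zero_of_mem (a := x) (by simp)
  exact div_ne_zero (Nat.cast_ne_zero.2 hN) hk hzero

theorem card_filter_comp_perm {γ α : Type*} [Fintype γ] [DecidableEq α] (π : Equiv.Perm γ)
    (f : γ → α) (i : α) :
    (Finset.univ.filter fun x => f (π x) = i).card =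
      (Finset.univ.filter fun x => f x = i).card :=
  Finset.card_equiv π (by simp)

theorem card_filter_fst_eq {α β : Type*} [Fintype α] [DecidableEq α] [Fintype β] (i : α) :
    (Finset.univ.filter fun x : α × β => x.1 = i).card = Fintype.card β := by
  rw [show (Finset.univ.filter fun x : α × β => x.1 = i) = {i} ×ˢ Finset.univ by
      ext; simp [Finset.mem_product, -Finset.singleton_product, -Finset.product_singleton],
    Finset.card_product, Finset.card_singleton, one_mul, Finset.card_univ]

theorem card_filter_snd_eq {α β : Type*} [Fintype α] [Fintype β] [DecidableEq β] (j : β) :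
    (Finset.univ.filter fun x : α × β => x.2 = j).card = Fintype.card α := by
  rw [show (Finset.univ.filter fun x : α × β => x.2 = j) = Finset.univ ×ˢ {j} by
      ext; simp [Finset.mem_product, -Finset.singleton_product, -Finset.product_singleton],
    Finset.card_product, Finset.card_singleton, mul_one, Finset.card_univ]

/-- The tensor product of two visibly full rank stencils is visibly full rank. -/
theorem stmt13 (n : ℕ) (A B : Matrix (Fin n) (Fin n) Bool)
    (hA : VisFullRank A) (hB : VisFullRank B) :
    VisFullRank (stTensor A B) := by
  obtain ⟨σ, hσ, hσ_unique⟩ := hA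
  obtain ⟨τ, hτ, hτ_unique⟩ := hB
  refine ⟨σ.prodCongr τ, fun x => by simp [stTensor, hσ, hτ], fun π hπ => ?_⟩
  simp only [stTensor, Matrix.of_apply, Bool.and_eq_true] at hπ
  refine Equiv.ext fun x => Prod.ext ?_ ?_
  · exact eq_perm_apply_of_fiber_card_eq hσ_unique (f := Prod.fst) (g := fun x => (π x).1)
      card_filter_fst_eq
      (fun i => (card_filter_comp_perm π Prod.fst i).trans (card_filter_fst_eq i))
      (fun x => (hπ x).1) x
  · exact eq_perm_apply_of_fiber_card_eq hτ_unique (f := Prod.snd) (g := fun x => (π x).2)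
      card_filter_snd_eq
      (fun j => (card_filter_comp_perm π Prod.snd j).trans (card_filter_snd_eq j))
      (fun x => (hπ x).2) x
end
end

section
/- For all stencils H1 and H2, the visible rank is super-multiplicative with respect to the stencil tensor product: vrk(H1 ⊗ H2) ≥ vrk(H1) · vrk(H2). -/
noncomputable section

/-- If a permutation of `α × β` moves the first coordinate only along stars of a visibly
full rank stencil, then it acts on the first coordinate as the unique star diagonal.
This follows from Birkhoff's theorem, applied to the normalized matrix of transition counts. -/
theorem fst_perm_apply_eq {α β : Type*} [Fintype α] [DecidableEq α] [Fintype β]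
    {M : Matrix α α Bool} {σ : Equiv.Perm α}
    (huniq : ∀ σ' : Equiv.Perm α, (∀ i, M i (σ' i) = true) → σ' = σ)
    (τ : Equiv.Perm (α × β)) (hτ : ∀ a, M a.1 (τ a).1 = true) (a : α × β) :
    (τ a).1 = σ a.1 := by
  have hβ : (Fintype.card β : ℚ) ≠ 0 := by
    have : Nonempty β := ⟨a.2⟩
    exact_mod_cast Fintype.card_ne_zero
  let N : Matrix α α ℚ := fun i j =>
    (∑ b : β, if (τ (i, b)).1 = j then 1 else 0) / Fintype.card β
  have hN : N ∈ doublyStochastic ℚ α := by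
    refine mem_doublyStochastic_iff_sum.2 ⟨fun i j => ?_, fun i => ?_, fun j => ?_⟩
    · exact div_nonneg (Finset.sum_nonneg fun b _ => by split_ifs <;> simp) (Nat.cast_nonneg _)
    · simp only [N]
      rw [← Finset.sum_div, Finset.sum_comm]
      simp [hβ]
    · simp only [N]
      rw [← Finset.sum_div,
        ← Fintype.sum_prod_type' (fun i b => if (τ (i, b)).1 = j then (1 : ℚ) else 0),
        Equiv.sum_comp τ (fun x => if x.1 = j then (1 : ℚ) else 0), Fintype.sum_prod_type_right]
      simp [hβ]
  obtain ⟨w, hw0, -, hwN⟩ := exists_eq_sum_perm_of_mem_doublyStochastic hN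
  have hentry (i j : α) : N i j = ∑ π : Equiv.Perm α, if π i = j then w π else 0 := by
    rw [← hwN, Matrix.sum_apply]
    simp [Equiv.Perm.permMatrix, PEquiv.toMatrix_apply, eq_comm]
  have hpos : 0 < N a.1 (τ a).1 := by
    refine div_pos (Finset.sum_pos' (fun b _ => by split_ifs <;> simp)
      ⟨a.2, Finset.mem_univ _, by simp⟩) (lt_of_le_of_ne (Nat.cast_nonneg _) hβ.symm)
  rw [hentry] at hpos
  obtain ⟨π, -, hπ⟩ := Finset.exists_ne_zero_of_sum_ne_zero hpos.ne'
  obtain ⟨hπa, hwπ⟩ : π a.1 = (τ a).1 ∧ w π ≠ 0 := by simpa using hπ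
  rw [← hπa, huniq π fun i => ?_]
  have hNi : N i (π i) ≠ 0 := by
    rw [hentry]
    refine (Finset.sum_pos' (fun ρ _ => by split_ifs <;> simp [hw0]) ⟨π, Finset.mem_univ _, ?_⟩).ne'
    simpa using lt_of_le_of_ne (hw0 π) hwπ.symm
  obtain ⟨b, -, hb⟩ := Finset.exists_ne_zero_of_sum_ne_zero (div_ne_zero_iff.1 hNi).1
  have hb' : (τ (i, b)).1 = π i := by simpa using hb
  simpa [hb'] using hτ (i, b)

/-- The tensor product of visibly full rank stencils is visibly full rank. -/
theorem VisFullRank.stTensor {α β : Type*} [Fintype α] [Fintype β]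
    {M : Matrix α α Bool} {N : Matrix β β Bool} (hM : VisFullRank M) (hN : VisFullRank N) :
    VisFullRank (stTensor M N) := by
  classical
  obtain ⟨σ, hσ, hσu⟩ := hM
  obtain ⟨ρ, hρ, hρu⟩ := hN
  refine ⟨σ.prodCongr ρ, fun a => by simp [_root_.stTensor, hσ, hρ], fun τ hτ => ?_⟩
  simp only [_root_.stTensor, Matrix.of_apply, Bool.and_eq_true] at hτ
  refine Equiv.ext fun a => Prod.ext ?_ ?_
  · exact fst_perm_apply_eq hσu τ (fun a => (hτ a).1) a
  · simpa using fst_perm_apply_eq hρu ((Equiv.prodComm α β).permCongr τ)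
      (fun b => by simpa using (hτ b.swap).2) a.swap

/-- Visible full rank is invariant under relabelling rows and columns by the same bijection. -/
theorem VisFullRank.submatrix {α γ : Type*} {M : Matrix α α Bool} (hM : VisFullRank M)
    (e : γ ≃ α) : VisFullRank (M.submatrix e e) := by
  obtain ⟨σ, hσ, hσu⟩ := hM
  refine ⟨e.symm.permCongr σ, fun i => by simp [hσ], fun τ hτ => ?_⟩
  rw [← hσu (e.permCongr τ) fun i => by simpa using hτ (e.symm i)]
  ext i
  simp

theorem bddAbove_visFullRank_sizes {α β : Type*} [Fintype α] (H : Matrix α β Bool) :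
    BddAbove {k : ℕ | ∃ r : Fin k → α, ∃ c : Fin k → β,
      Function.Injective r ∧ Function.Injective c ∧
      VisFullRank (Matrix.of fun i j => H (r i) (c j))} := by
  refine ⟨Fintype.card α, ?_⟩
  rintro k ⟨r, -, hr, -⟩
  simpa using Fintype.card_le_of_injective r hr

/-- The visible rank is attained by a sub-stencil. -/
theorem exists_visFullRank_vrk {α β : Type*} [Fintype α] (H : Matrix α β Bool) :
    ∃ r : Fin (vrk H) → α, ∃ c : Fin (vrk H) → β,
      Function.Injective r ∧ Function.Injective c ∧
      VisFullRank (Matrix.of fun i j => H (r i) (c j)) := by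
  refine Nat.sSup_mem ?_ (bddAbove_visFullRank_sizes H)
  refine ⟨0, fun i => i.elim0, fun i => i.elim0, fun i => i.elim0, fun i => i.elim0, ?_⟩
  exact ⟨1, fun i => i.elim0, fun _ _ => Subsingleton.elim _ _⟩

/-- The visible rank is super-multiplicative with respect to the stencil tensor product. -/
theorem stmt14 (m₁ n₁ m₂ n₂ : ℕ)
    (H₁ : Matrix (Fin m₁) (Fin n₁) Bool) (H₂ : Matrix (Fin m₂) (Fin n₂) Bool) :
    vrk H₁ * vrk H₂ ≤ vrk (stTensor H₁ H₂) := by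
  obtain ⟨r₁, c₁, hr₁, hc₁, h₁⟩ := exists_visFullRank_vrk H₁
  obtain ⟨r₂, c₂, hr₂, hc₂, h₂⟩ := exists_visFullRank_vrk H₂
  let e : Fin (vrk H₁ * vrk H₂) ≃ Fin (vrk H₁) × Fin (vrk H₂) := finProdFinEquiv.symm
  exact le_csSup (bddAbove_visFullRank_sizes _)
    ⟨Prod.map r₁ r₂ ∘ e, Prod.map c₁ c₂ ∘ e, (hr₁.prodMap hr₂).comp e.injective,
      (hc₁.prodMap hc₂).comp e.injective, (h₁.stTensor h₂).submatrix e⟩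
end
end

section
/- For stencils H1 of size m1 × n1 and H2 of size m2 × n2, the visible rank of their tensor product satisfies vrk(H1 ⊗ H2) ≤ vrk(H1) · n2. -/
noncomputable section

/-- A family of diagonal cells of `H` admitting no other generalized diagonal of stars
bounds the visible rank from below. -/
theorem card_le_vrk {ι α β : Type*} [Fintype ι] [Finite α] (H : Matrix α β Bool)
    (r : ι → α) (c : ι → β) (hd : ∀ i, H (r i) (c i) = true)
    (hu : ∀ σ : Equiv.Perm ι, (∀ i, H (r i) (c (σ i)) = true) → σ = 1) :
    Fintype.card ι ≤ vrk H := by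
  classical
  have hinj : ∀ i j, r i = r j ∨ c i = c j → i = j := by
    intro i j h
    refine Equiv.swap_eq_one_iff.1 (hu (Equiv.swap i j) fun l => ?_)
    rcases eq_or_ne l i with rfl | hi
    · rw [Equiv.swap_apply_left]
      rcases h with h | h
      · rw [h]; exact hd j
      · rw [← h]; exact hd l
    rcases eq_or_ne l j with rfl | hj
    · rw [Equiv.swap_apply_right]
      rcases h with h | h
      · rw [← h]; exact hd i
      · rw [h]; exact hd l
    · rw [Equiv.swap_apply_of_ne_of_ne hi hj]; exact hd l
  let e := Fintype.equivFin ι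
  refine le_csSup ⟨Nat.card α, ?_⟩ ⟨r ∘ e.symm, c ∘ e.symm, ?_, ?_, 1, ?_, ?_⟩
  · rintro k ⟨r', -, hr', -⟩
    simpa using Nat.card_le_card_of_injective r' hr'
  · exact fun i j h => e.symm.injective (hinj _ _ (Or.inl h))
  · exact fun i j h => e.symm.injective (hinj _ _ (Or.inr h))
  · exact fun i => hd _
  · intro τ hτ
    have h := hu ((e.trans τ).trans e.symm) fun i => by simpa using hτ (e i)
    ext i : 1
    have h' := Equiv.congr_fun h (e.symm i)
    simpa using h'

/-- `vrk (H₁ ⊗ H₂) ≤ vrk H₁ · n₂`. -/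
theorem stmt15 (m₁ n₁ m₂ n₂ : ℕ)
    (H₁ : Matrix (Fin m₁) (Fin n₁) Bool) (H₂ : Matrix (Fin m₂) (Fin n₂) Bool) :
    vrk (stTensor H₁ H₂) ≤ vrk H₁ * n₂ := by
  classical
  refine csSup_le' ?_
  rintro k ⟨r, c, -, -, σ, hσ, hu⟩
  simp only [stTensor, Matrix.of_apply, Bool.and_eq_true] at hσ hu
  have hfib : ∀ t : Fin n₂, Fintype.card {i : Fin k // (c (σ i)).2 = t} ≤ vrk H₁ := by
    intro t
    refine card_le_vrk H₁ (fun i => (r i).1) (fun i => (c (σ i)).1) (fun i => (hσ i).1) ?_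
    intro τ hτ
    have h : (Equiv.Perm.ofSubtype τ).trans σ = σ := by
      refine hu _ fun i => ?_
      by_cases hi : (c (σ i)).2 = t
      · have hH := (hσ i).2
        rw [hi] at hH
        rw [Equiv.trans_apply, Equiv.Perm.ofSubtype_apply_of_mem τ hi, (τ ⟨i, hi⟩).2]
        exact ⟨hτ ⟨i, hi⟩, hH⟩
      · rw [Equiv.trans_apply, Equiv.Perm.ofSubtype_apply_of_not_mem τ hi]
        exact hσ i
    ext i : 2
    have h' := σ.injective (Equiv.congr_fun h i)
    rwa [Equiv.Perm.ofSubtype_apply_coe] at h'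
  have hcard := Finset.card_le_mul_card_image_of_maps_to
    (s := (Finset.univ : Finset (Fin k))) (t := (Finset.univ : Finset (Fin n₂)))
    (f := fun i => (c (σ i)).2) (fun _ _ => Finset.mem_univ _) (vrk H₁)
    (fun t _ => by rw [← Fintype.card_subtype]; exact hfib t)
  simpa using hcard
end
end

section
/- Let n ≥ 2 and let D be the n × n stencil with D[i,i] = 0 for all i and D[i,j] = ⋆ for all i ≠ j. Then vrk(D) = 2, while the F₂-rank of D is at least n − 1 (i.e., every matrix over the two-element field F₂ whose off-diagonal entries are all nonzero and whose diagonal entries are all zero has rank at least n − 1). -/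
noncomputable section

/-- In a stencil whose only zeros are on the diagonal, every visibly full rank sub-stencil has
size at most two. -/
lemma VisFullRank.le_two_of_injective {α : Type*} {k : ℕ} {D : Matrix α α Bool}
    (hD : ∀ i j, D i j = true ↔ i ≠ j) {r c : Fin k → α}
    (hr : Function.Injective r) (hc : Function.Injective c)
    (h : VisFullRank (Matrix.of fun i j => D (r i) (c j))) : k ≤ 2 := by
  by_contra! hk
  obtain ⟨σ, hσ, huniq⟩ := h
  simp only [Matrix.of_apply, hD] at hσ huniq
  have key : ∀ τ : Equiv.Perm (Fin k), τ ≠ 1 → ∃ i, τ i ≠ i ∧ r i = c (σ (τ i)) := by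
    intro τ hτ
    by_contra! hcon
    refine hτ (mul_left_cancel (a := σ) ?_)
    rw [mul_one]
    refine huniq _ fun i => ?_
    by_cases hi : τ i = i
    · simpa [hi] using hσ i
    · exact hcon i hi
  have hf : Function.Injective fun i => c (σ i) := hc.comp σ.injective
  have pair : ∀ i j, i ≠ j → r i = c (σ j) ∨ r j = c (σ i) := by
    intro i j hij
    obtain ⟨x, hx, hrx⟩ := key (Equiv.swap i j)
      (by simpa [Equiv.Perm.one_def] using hij)
    by_cases h1 : x = i
    · subst h1; left; simpa using hrx
    · by_cases h2 : x = j
      · subst h2; right; simpa using hrx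
      · exact absurd (Equiv.swap_apply_of_ne_of_ne h1 h2) hx
  have cyc : ∀ i j l, i ≠ j → i ≠ l → j ≠ l →
      r i = c (σ j) ∨ r j = c (σ l) ∨ r l = c (σ i) := by
    intro i j l hij hil hjl
    have ei : (Equiv.swap i j * Equiv.swap j l) i = j := by
      simp [Equiv.swap_apply_of_ne_of_ne hij hil]
    have ej : (Equiv.swap i j * Equiv.swap j l) j = l := by
      simp [Equiv.swap_apply_of_ne_of_ne hil.symm hjl.symm]
    have el : (Equiv.swap i j * Equiv.swap j l) l = i := by simp
    obtain ⟨x, hx, hrx⟩ := key (Equiv.swap i j * Equiv.swap j l)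
      (fun h => hij (by simpa [h] using ei))
    by_cases h1 : x = i
    · subst h1; left; rwa [ei] at hrx
    by_cases h2 : x = j
    · subst h2; right; left; rwa [ej] at hrx
    by_cases h3 : x = l
    · subst h3; right; right; rwa [el] at hrx
    · refine absurd ?_ hx
      simp [Equiv.swap_apply_of_ne_of_ne h1 h2, Equiv.swap_apply_of_ne_of_ne h2 h3]
  obtain ⟨i, j, l, hij, hil, hjl⟩ : ∃ i j l : Fin k, i ≠ j ∧ i ≠ l ∧ j ≠ l :=
    ⟨⟨0, by omega⟩, ⟨1, by omega⟩, ⟨2, by omega⟩, by simp, by simp, by simp⟩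
  have hout : ∀ x y z, r x = c (σ y) → r x = c (σ z) → y = z :=
    fun x y z h1 h2 => hf (h1.symm.trans h2)
  have hin : ∀ x y z, r x = c (σ z) → r y = c (σ z) → x = y :=
    fun x y z h1 h2 => hr (h1.trans h2.symm)
  have p1 := pair i j hij
  have p2 := pair i l hil
  have p3 := pair j l hjl
  have c1 := cyc i j l hij hil hjl
  have c2 := cyc i l j hil hij hjl.symm
  grind

/-- The visible rank of the complement of the diagonal is two. -/
lemma vrk_eq_two_of_offDiag {α : Type*} [Nontrivial α] {D : Matrix α α Bool}
    (hD : ∀ i j, D i j = true ↔ i ≠ j) : vrk D = 2 := by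
  refine IsGreatest.csSup_eq ⟨?_, ?_⟩
  · obtain ⟨a, b, hab⟩ := exists_pair_ne α
    have hinj : Function.Injective ![a, b] := by
      intro i j
      fin_cases i <;> fin_cases j <;> simp [hab, hab.symm]
    refine ⟨![a, b], ![a, b], hinj, hinj, Equiv.swap 0 1, ?_, ?_⟩
    · simp [hD, Fin.forall_fin_two, hab, hab.symm]
    · intro τ hτ
      simp only [Matrix.of_apply, hD, hinj.ne_iff] at hτ
      revert τ
      decide
  · rintro k ⟨r, c, hr, hc, h⟩
    exact h.le_two_of_injective hD hr hc

/-- The rank of matrices over a field is subadditive. -/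
lemma Matrix.rank_add_le_rank_add_rank {m n F : Type*} [Fintype m] [Fintype n] [Field F]
    (A B : Matrix m n F) : (A + B).rank ≤ A.rank + B.rank := by
  unfold Matrix.rank
  rw [Matrix.mulVecLin_add]
  exact (Submodule.finrank_mono (LinearMap.range_add_le _ _)).trans
    (Submodule.finrank_add_le_finrank_add_finrank _ _)

/-- An `𝔽₂`-witness of the complement of the diagonal has corank at most one. -/
lemma IsWitness.card_sub_one_le_rank {α : Type*} [Fintype α] [DecidableEq α]
    {D : Matrix α α Bool} (hD : ∀ i j, D i j = true ↔ i ≠ j) {W : Matrix α α (ZMod 2)}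
    (hW : IsWitness D W) : Fintype.card α - 1 ≤ W.rank := by
  have hsum : (1 : Matrix α α (ZMod 2)) = W + Matrix.vecMulVec (fun _ => 1) (fun _ => 1) := by
    ext i j
    have hw := hW i j
    rw [hD] at hw
    have hbit : ∀ x : ZMod 2, (x ≠ 0 → 0 = x + 1) ∧ (x = 0 → 1 = x + 1) := by decide
    by_cases hij : i = j
    · subst hij
      simpa [Matrix.vecMulVec_apply] using (hbit (W i i)).2 (by simpa using hw)
    · simpa [Matrix.vecMulVec_apply, hij] using (hbit (W i j)).1 (hw.2 hij)
  have h1 := Matrix.rank_add_le_rank_add_rank W (Matrix.vecMulVec (fun _ => 1) (fun _ => 1))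
  have h2 := Matrix.rank_vecMulVec_le (R := ZMod 2) (fun _ : α => 1) (fun _ : α => 1)
  rw [← hsum, Matrix.rank_one] at h1
  omega

/-- The stencil with 0's on the diagonal and ⋆'s elsewhere has visible rank 2,
but its rank over `F₂` is at least `n - 1`. -/
theorem stmt19 (n : ℕ) (hn : 2 ≤ n) (D : Matrix (Fin n) (Fin n) Bool)
    (hD : ∀ i j, D i j = true ↔ i ≠ j) :
    vrk D = 2 ∧ n - 1 ≤ frk (ZMod 2) D := by
  have : Nontrivial (Fin n) := Fin.nontrivial_iff_two_le.2 hn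
  refine ⟨vrk_eq_two_of_offDiag hD, le_csInf ?_ ?_⟩
  · exact ⟨_, Matrix.of fun i j => if D i j = true then 1 else 0, fun i j => by simp, rfl⟩
  · rintro _ ⟨W, hW, rfl⟩
    simpa using hW.card_sub_one_le_rank hD
end
end
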